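/- Let (Σ1, ⊥1) and (Σ2, ⊥2) be T1 orthogonality spaces, and equip Σ1 × Σ2 with the product orthogonality. Suppose p1 ≠ q1 in Σ1 with ¬(p1 ⊥1 q1), and p2 ≠ q2 in Σ2 with ¬(p2 ⊥2 q2). Set a = {(p1, p2)} and b = {(p1, p2), (q1, q2)}. Then a and b are biorthogonally closed, a is strictly contained in b, b ∩ a^⊥ = ∅, and hence (a ∪ (b ∩ a^⊥))^⊥⊥ = a ≠ b. Consequently the orthomodular law a ≤ b ⟹ b = a ∨ (b ∧ a^⊥) fails in the complete ortholattice of biorthogonally closed subsets of Σ1 × Σ2. -/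

import Mathlib

/-- The orthogonal set of `A`: all points orthogonal to every point of `A`. -/
def orthoSet {α : Type*} (perp : α → α → Prop) (A : Set α) : Set α :=
  {q | ∀ p ∈ A, perp q p}

/-- The product orthogonality on `α × β`:
`(p1, p2) ⊥ (q1, q2)` iff `p1 ⊥1 q1` or `p2 ⊥2 q2`. -/
def prodPerp {α β : Type*} (perp1 : α → α → Prop) (perp2 : β → β → Prop) :
    α × β → α × β → Prop :=
  fun x y => perp1 x.1 y.1 ∨ perp2 x.2 y.2


theorem subset_orthoSet_orthoSet {α : Type*} {perp : α → α → Prop}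
    (symm : ∀ x y, perp x y → perp y x) (A : Set α) :
    A ⊆ orthoSet perp (orthoSet perp A) :=
  fun x hx y hy => symm y x (hy x hx)

theorem eq_of_forall_perp {α : Type*} {perp : α → α → Prop} {p x : α}
    (hT1 : orthoSet perp (orthoSet perp {p}) = {p})
    (h : ∀ u, perp u p → perp x u) : x = p := by
  have hx : x ∈ orthoSet perp (orthoSet perp {p}) := fun u hu => h u (hu p rfl)
  rwa [hT1] at hx

theorem eq_or_eq_of_forall_perp_or_perp {α β : Type*} {perp1 : α → α → Prop}
    {perp2 : β → β → Prop} {p x : α} {q y : β}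
    (hp : orthoSet perp1 (orthoSet perp1 {p}) = {p})
    (hq : orthoSet perp2 (orthoSet perp2 {q}) = {q})
    (h : ∀ u v, perp1 u p → perp2 v q → perp1 x u ∨ perp2 y v) : x = p ∨ y = q := by
  by_contra! hne
  refine hne.1 (eq_of_forall_perp hp fun u hu => ?_)
  by_contra hxu
  exact hne.2 (eq_of_forall_perp hq fun v hv => (h u v hu hv).resolve_left hxu)

theorem orthoSet_prodPerp_orthoSet_singleton {α β : Type*} {perp1 : α → α → Prop}
    {perp2 : β → β → Prop}
    (h1_irrefl : ∀ x, ¬ perp1 x x) (h1_symm : ∀ x y, perp1 x y → perp1 y x)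
    (h2_irrefl : ∀ x, ¬ perp2 x x) (h2_symm : ∀ x y, perp2 x y → perp2 y x)
    {p1 : α} {p2 : β}
    (hp1 : orthoSet perp1 (orthoSet perp1 {p1}) = {p1})
    (hp2 : orthoSet perp2 (orthoSet perp2 {p2}) = {p2}) :
    orthoSet (prodPerp perp1 perp2) (orthoSet (prodPerp perp1 perp2) {(p1, p2)}) =
      {(p1, p2)} := by
  refine Set.Subset.antisymm ?_
    (subset_orthoSet_orthoSet (fun x y => Or.imp (h1_symm _ _) (h2_symm _ _)) _)
  rintro ⟨x, y⟩ h
  have hx : x = p1 := eq_of_forall_perp hp1 fun u hu =>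
    (h (u, y) (by rintro _ rfl; exact Or.inl hu)).resolve_right (h2_irrefl y)
  have hy : y = p2 := eq_of_forall_perp hp2 fun v hv =>
    (h (x, v) (by rintro _ rfl; exact Or.inr hv)).resolve_left (h1_irrefl x)
  rw [hx, hy]
  rfl

theorem orthoSet_prodPerp_orthoSet_pair {α β : Type*} {perp1 : α → α → Prop}
    {perp2 : β → β → Prop}
    (h1_symm : ∀ x y, perp1 x y → perp1 y x) (h2_symm : ∀ x y, perp2 x y → perp2 y x)
    (hT1_1 : ∀ p : α, orthoSet perp1 (orthoSet perp1 {p}) = {p})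
    (hT1_2 : ∀ p : β, orthoSet perp2 (orthoSet perp2 {p}) = {p})
    {p1 q1 : α} {p2 q2 : β} (h1 : p1 ≠ q1) (h2 : p2 ≠ q2) :
    orthoSet (prodPerp perp1 perp2)
        (orthoSet (prodPerp perp1 perp2) {(p1, p2), (q1, q2)}) =
      {(p1, p2), (q1, q2)} := by
  refine Set.Subset.antisymm ?_
    (subset_orthoSet_orthoSet (fun x y => Or.imp (h1_symm _ _) (h2_symm _ _)) _)
  rintro ⟨x, y⟩ h
  have hpq : x = p1 ∨ y = q2 :=
    eq_or_eq_of_forall_perp_or_perp (hT1_1 p1) (hT1_2 q2) fun u v hu hv =>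
      h (u, v) (by rintro _ (rfl | rfl); exacts [Or.inl hu, Or.inr hv])
  have hqp : x = q1 ∨ y = p2 :=
    eq_or_eq_of_forall_perp_or_perp (hT1_1 q1) (hT1_2 p2) fun u v hu hv =>
      h (u, v) (by rintro _ (rfl | rfl); exacts [Or.inr hv, Or.inl hu])
  rcases hpq with rfl | rfl <;> rcases hqp with rfl | rfl
  · exact absurd rfl h1
  · exact Or.inl rfl
  · exact Or.inr rfl
  · exact absurd rfl h2

/-- Failure of the orthomodular law in the lattice of biorthogonally closed subsets of
the product of two T1 orthogonality spaces: with `a = {(p1, p2)}` and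
`b = {(p1, p2), (q1, q2)}` (where `p1 ≠ q1`, `¬ p1 ⊥1 q1`, `p2 ≠ q2`, `¬ p2 ⊥2 q2`),
both `a` and `b` are biorthogonally closed, `a ⊊ b`, `b ∩ a^⊥ = ∅`, hence
`a ∨ (b ∧ a^⊥) = (a ∪ (b ∩ a^⊥))^⊥⊥ = a ≠ b`. -/
theorem orthomodularity_fails {α β : Type*} (perp1 : α → α → Prop) (perp2 : β → β → Prop)
    (h1_irrefl : ∀ x, ¬ perp1 x x) (h1_symm : ∀ x y, perp1 x y → perp1 y x)
    (h2_irrefl : ∀ x, ¬ perp2 x x) (h2_symm : ∀ x y, perp2 x y → perp2 y x)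
    (hT1_1 : ∀ p : α, orthoSet perp1 (orthoSet perp1 {p}) = {p})
    (hT1_2 : ∀ p : β, orthoSet perp2 (orthoSet perp2 {p}) = {p})
    (p1 q1 : α) (p2 q2 : β)
    (hq1 : p1 ≠ q1) (hnp1 : ¬ perp1 p1 q1)
    (hq2 : p2 ≠ q2) (hnp2 : ¬ perp2 p2 q2) :
    let pp := prodPerp perp1 perp2
    let a : Set (α × β) := {(p1, p2)}
    let b : Set (α × β) := {(p1, p2), (q1, q2)}
    orthoSet pp (orthoSet pp a) = a ∧
    orthoSet pp (orthoSet pp b) = b ∧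
    a ⊂ b ∧
    b ∩ orthoSet pp a = ∅ ∧
    orthoSet pp (orthoSet pp (a ∪ (b ∩ orthoSet pp a))) = a ∧
    a ≠ b := by
  intro pp a b
  have ha : orthoSet pp (orthoSet pp a) = a :=
    orthoSet_prodPerp_orthoSet_singleton h1_irrefl h1_symm h2_irrefl h2_symm
      (hT1_1 p1) (hT1_2 p2)
  have hb : orthoSet pp (orthoSet pp b) = b :=
    orthoSet_prodPerp_orthoSet_pair h1_symm h2_symm hT1_1 hT1_2 hq1 hq2
  have hab : a ⊂ b := by
    refine ⟨Set.singleton_subset_iff.2 (Or.inl rfl), fun hba => hq1 ?_⟩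
    have hq : (q1, q2) = (p1, p2) := hba (Or.inr rfl)
    exact (congrArg Prod.fst hq).symm
  have hinter : b ∩ orthoSet pp a = ∅ := by
    refine Set.eq_empty_of_forall_notMem ?_
    rintro _ ⟨rfl | rfl, h⟩
    · exact (h _ rfl).elim (h1_irrefl _) (h2_irrefl _)
    · exact (h _ rfl).elim (fun h => hnp1 (h1_symm _ _ h)) (fun h => hnp2 (h2_symm _ _ h))
  exact ⟨ha, hb, hab, hinter, by rw [hinter, Set.union_empty, ha], hab.ne⟩
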